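/- Let R be an injective bounded linear operator on a complex Hilbert space H, and let θ be the partial-isometry factor of the polar decomposition of R, i.e., θ is a bounded operator on H satisfying θ(√(R*R) x) = R x for every x ∈ H, where √(R*R) is the positive square root of R*R. If a bounded operator S on H commutes with R_k for every k ∈ ℕ, then S commutes with θ* R_j θ for every j ∈ ℕ. -/

import Mathlib

open ContinuousLinearMap

variable {H : Type*} [NormedAddCommGroup H] [InnerProductSpace ℂ H] [CompleteSpace H]

noncomputable def opT (R : H →L[ℂ] H) (k : ℕ) : H →L[ℂ] H :=
  ContinuousLinearMap.adjoint (R ^ k) ∘L (R ^ k)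

theorem ContinuousLinearMap.IsPositive.commute_of_commute_mul_self {Q S : H →L[ℂ] H}
    (hQ : Q.IsPositive) (hS : Commute S (Q * Q)) : Commute S Q := by
  have hQ0 : 0 ≤ Q := (ContinuousLinearMap.nonneg_iff_isPositive Q).mpr hQ
  rw [← CFC.sqrt_mul_self Q hQ0]
  exact (hS.symm.cfcₙ_nnreal _).symm

theorem ContinuousLinearMap.eq_zero_of_mul_mul_self_eq_zero {Q D : H →L[ℂ] H}
    (hQ : IsSelfAdjoint Q) (hinj : Function.Injective Q) (h : Q * D * Q = 0) : D = 0 := by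
  have cancel (A : H →L[ℂ] H) (hA : Q * A = 0) : A = 0 := by
    ext x
    exact hinj (by simpa using DFunLike.congr_fun hA x)
  have hDQ : D * Q = 0 := cancel _ (by rw [← mul_assoc, h])
  have hstar : Q * star D = 0 := by
    simpa [hQ.star_eq] using congrArg star hDQ
  exact star_eq_zero.mp (cancel _ hstar)

/-- if `R` is injective, `Q` is the positive square root of `R*R`, and `θ` is
the partial-isometry factor of the polar decomposition of `R` (so `θ (Q x) = R x` for all `x`),
then any bounded operator `S` commuting with every `R_k` also commutes with every `θ* R_j θ`. -/
theorem commute_adjoint_polar_part (R : H →L[ℂ] H) (hinj : Function.Injective R)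
    (Q : H →L[ℂ] H) (hQpos : Q.IsPositive)
    (hQsq : Q ∘L Q = ContinuousLinearMap.adjoint R ∘L R)
    (θ : H →L[ℂ] H) (hθ : ∀ x : H, θ (Q x) = R x)
    (S : H →L[ℂ] H) (hS : ∀ k : ℕ, Commute S (opT R k)) :
    ∀ j : ℕ, Commute S (ContinuousLinearMap.adjoint θ ∘L opT R j ∘L θ) := by
  intro j
  have hQsa : IsSelfAdjoint Q := hQpos.isSelfAdjoint
  have hθQ : θ * Q = R := ContinuousLinearMap.ext hθ
  have hQθ : Q * star θ = star R := by
    rw [← hθQ, star_mul, hQsa.star_eq]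
  have hQinj : Function.Injective Q := fun x y hxy => hinj (by rw [← hθ, ← hθ, hxy])
  have hSQ : Commute S Q := hQpos.commute_of_commute_mul_self (by
    have h1 := hS 1
    rw [opT, pow_one, ← hQsq] at h1
    exact h1)
  have hX : Q * (star θ * (opT R j * θ)) * Q = opT R (j + 1) := by
    calc Q * (star θ * (opT R j * θ)) * Q = (Q * star θ) * opT R j * (θ * Q) := by
          simp only [mul_assoc]
      _ = star R * (star (R ^ j) * R ^ j) * R := by rw [hθQ, hQθ]; rfl
      _ = star (R ^ (j + 1)) * R ^ (j + 1) := by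
          rw [pow_succ, star_mul]; simp only [mul_assoc]
  change S * (star θ * (opT R j * θ)) = (star θ * (opT R j * θ)) * S
  generalize star θ * (opT R j * θ) = X at hX ⊢
  refine sub_eq_zero.mp
    (ContinuousLinearMap.eq_zero_of_mul_mul_self_eq_zero hQsa hQinj ?_)
  calc Q * (S * X - X * S) * Q = (Q * S) * X * Q - Q * X * (S * Q) := by
        noncomm_ring
    _ = S * (Q * X * Q) - (Q * X * Q) * S := by
        rw [← hSQ.eq]; nth_rewrite 2 [hSQ.eq]; simp only [mul_assoc]
    _ = 0 := by rw [hX, (hS (j + 1)).eq, sub_self]
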